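/- Let v ∈ W^P and let β be a maximal element of Φ⁺(v) with respect to the dominance order, and set α = −v(β). Then α is a simple root and s_α v < v in the Bruhat order. -/

import Mathlib

open scoped RealInnerProductSpace
open Classical

noncomputable section

variable (V : Type) [NormedAddCommGroup V] [InnerProductSpace ℝ V]

/-- The reflection determined by a vector `α` (the identity map if `α = 0`),
as a linear endomorphism:  `x ↦ x - (2⟪x,α⟫/⟪α,α⟫) • α`. -/
def reflMap (α : V) : V →ₗ[ℝ] V where
  toFun x := x - (2 * ⟪x, α⟫ / ⟪α, α⟫) • α
  map_add' x y := by
    simp only [inner_add_left]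
    rw [show 2 * (⟪x, α⟫ + ⟪y, α⟫) / ⟪α, α⟫
        = 2 * ⟪x, α⟫ / ⟪α, α⟫ + 2 * ⟪y, α⟫ / ⟪α, α⟫ by ring, add_smul]
    abel
  map_smul' c x := by
    simp only [real_inner_smul_left, RingHom.id_apply, smul_sub]
    rw [show 2 * (c * ⟪x, α⟫) / ⟪α, α⟫ = c * (2 * ⟪x, α⟫ / ⟪α, α⟫) by ring,
      mul_smul]

lemma reflMap_apply (α x : V) :
    reflMap V α x = x - (2 * ⟪x, α⟫ / ⟪α, α⟫) • α := rfl

lemma reflMap_involutive (α : V) : ∀ x, reflMap V α (reflMap V α x) = x := by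
  intro x
  by_cases h : (⟪α, α⟫ : ℝ) = 0
  · have h0 : α = 0 := inner_self_eq_zero.mp h
    simp [reflMap_apply, h0]
  · rw [reflMap_apply, reflMap_apply, inner_sub_left, real_inner_smul_left,
      div_mul_cancel₀ _ h]
    rw [show ⟪x, α⟫ - 2 * ⟪x, α⟫ = -⟪x, α⟫ by ring]
    rw [show 2 * -⟪x, α⟫ / ⟪α, α⟫ = -(2 * ⟪x, α⟫ / ⟪α, α⟫) by ring, neg_smul]
    abel

/-- The reflection determined by a vector `α`, as a linear automorphism of `V`. -/
def sref (α : V) : V ≃ₗ[ℝ] V :=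
  { reflMap V α with
    invFun := reflMap V α
    left_inv := reflMap_involutive V α
    right_inv := reflMap_involutive V α }

lemma sref_apply (α x : V) :
    sref V α x = x - (2 * ⟪x, α⟫ / ⟪α, α⟫) • α := rfl

variable {V}

/-- The coroot `α^∨ = 2α/⟪α,α⟫` associated with a root `α`, under the identification of the
coweight space with `V` given by the inner product. -/
def coroot (α : V) : V := (2 / ⟪α, α⟫) • α

/-- The dimension of the `(-1)`-eigenspace of a linear automorphism. -/
def lamEig (σ : V ≃ₗ[ℝ] V) : ℕ :=
  Module.finrank ℝ (Module.End.eigenspace (σ : V →ₗ[ℝ] V) (-1))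

/-- The action `s_α ∘ σ` of a simple reflection on an involution: `s_α σ` if `s_α` and `σ`
commute, and `s_α σ s_α` otherwise. -/
def circAct (α : V) (σ : V ≃ₗ[ℝ] V) : V ≃ₗ[ℝ] V :=
  if sref V α * σ = σ * sref V α then sref V α * σ else sref V α * σ * sref V α

/-- A set of pairwise orthogonal vectors. -/
def OrthSet (S : Finset V) : Prop :=
  (↑S : Set V).Pairwise fun a b => ⟪a, b⟫ = 0

/-- The product `σ_S` of the (commuting) reflections in the elements of an orthogonal set
`S`. -/
def sigmaOf (S : Finset V) : V ≃ₗ[ℝ] V :=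
  (S.toList.map (sref V)).prod

variable (V)

/-- A finite crystallographic reduced root system in the Euclidean space `V`,
together with a fixed choice of simple roots. -/
structure RSD where
  /-- The set of roots. -/
  Φ : Finset V
  /-- The set of simple roots. -/
  Δ : Finset V
  nonzero : (0 : V) ∉ Φ
  span_top : Submodule.span ℝ (Φ : Set V) = ⊤
  reduced : ∀ α ∈ Φ, ∀ c : ℝ, c • α ∈ Φ → c = 1 ∨ c = -1
  crystal : ∀ α ∈ Φ, ∀ β ∈ Φ, ∃ n : ℤ, (n : ℝ) = 2 * ⟪β, α⟫ / ⟪α, α⟫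
  reflClosed : ∀ α ∈ Φ, ∀ β ∈ Φ, sref V α β ∈ Φ
  Δ_sub : Δ ⊆ Φ
  Δ_indep : LinearIndependent ℝ (fun x : (Δ : Set V) => (x : V))
  Δ_base : ∀ α ∈ Φ, (∃ c : V → ℕ, α = ∑ γ ∈ Δ, (c γ : ℝ) • γ) ∨
      (∃ c : V → ℕ, -α = ∑ γ ∈ Δ, (c γ : ℝ) • γ)

namespace RSD

variable {V}
variable (D : RSD V)

/-- The set of positive roots. -/
def Pos : Set V :=
  {α | α ∈ D.Φ ∧ ∃ c : V → ℕ, α = ∑ γ ∈ D.Δ, (c γ : ℝ) • γ}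

/-- The set of negative roots. -/
def Neg : Set V := {α | -α ∈ D.Pos}

/-- The Weyl group, as the subgroup of `GL(V)` generated by the simple reflections. -/
def W : Subgroup (V ≃ₗ[ℝ] V) := Subgroup.closure ((fun γ => sref V γ) '' ↑D.Δ)

/-- The length of `w`: the least number of simple reflections needed to write `w` as a
product of simple reflections. -/
def length (w : V ≃ₗ[ℝ] V) : ℕ :=
  sInf {n | ∃ l : List V, l.length = n ∧ (∀ γ ∈ l, γ ∈ D.Δ) ∧ w = (l.map (sref V)).prod}

/-- The Bruhat order on the Weyl group: `u ≤ v` iff `v` is obtained from `u` by successively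
multiplying by reflections, each time increasing the length. -/
def ble (u v : V ≃ₗ[ℝ] V) : Prop :=
  Relation.ReflTransGen
    (fun x y => (∃ β ∈ D.Φ, y = sref V β * x) ∧ D.length x < D.length y) u v

/-- The strict Bruhat order. -/
def blt (u v : V ≃ₗ[ℝ] V) : Prop := D.ble u v ∧ u ≠ v

/-- The dominance order: `y - x` is a nonnegative integer combination of simple roots. -/
def dom (x y : V) : Prop := ∃ c : V → ℕ, y - x = ∑ γ ∈ D.Δ, (c γ : ℝ) • γ

/-- The dominance order on coweights: `y - x` is a nonnegative integer combination of simple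
coroots. -/
def cdom (x y : V) : Prop := ∃ c : V → ℕ, y - x = ∑ γ ∈ D.Δ, (c γ : ℝ) • coroot γ

/-- The length `L(σ) = (ℓ(σ) + λ(σ))/2` of an involution `σ`, where `λ(σ)` is the dimension
of the `(-1)`-eigenspace of `σ`. -/
def Linv (σ : V ≃ₗ[ℝ] V) : ℚ :=
  ((D.length σ : ℚ) + (lamEig σ : ℚ)) / 2

end RSD

/-- A finite irreducible crystallographic reduced root system, with a fixed choice of simple
roots and a marked simple root `αP` whose coefficient in the highest root `θ` equals `1`
(the cominuscule case). -/
structure MRSD extends RSD V where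
  irred : ¬ ∃ A B : Set V, A.Nonempty ∧ B.Nonempty ∧ A ∪ B = ↑Φ ∧
      ∀ α ∈ A, ∀ β ∈ B, ⟪α, β⟫ = 0
  /-- The marked simple root. -/
  αP : V
  αP_mem : αP ∈ Δ
  /-- The highest root. -/
  θ : V
  θ_mem : θ ∈ Φ
  θ_high : ∀ α ∈ Φ, ∃ c : V → ℕ, θ - α = ∑ γ ∈ Δ, (c γ : ℝ) • γ
  θ_coeff : ∃ c : V → ℕ, (θ = ∑ γ ∈ Δ, (c γ : ℝ) • γ) ∧ c αP = 1

namespace MRSD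

variable {V}
variable (M : MRSD V)

/-- The set `Ψ` of positive roots in which the marked simple root `αP` has coefficient `1`. -/
def Psi : Set V :=
  {α | α ∈ M.Φ ∧ ∃ c : V → ℕ, (α = ∑ γ ∈ M.Δ, (c γ : ℝ) • γ) ∧ c M.αP = 1}

/-- The set of positive roots of the subsystem `Φ_P`, i.e. the positive roots in which the
marked simple root `αP` has coefficient `0`. -/
def PosP : Set V :=
  {α | α ∈ M.Φ ∧ ∃ c : V → ℕ, (α = ∑ γ ∈ M.Δ, (c γ : ℝ) • γ) ∧ c M.αP = 0}

/-- The parabolic subgroup `W_P` generated by the simple reflections in `Δ ∖ {αP}`. -/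
def WP : Subgroup (V ≃ₗ[ℝ] V) :=
  Subgroup.closure ((fun γ => sref V γ) '' ↑(M.Δ.erase M.αP))

/-- The inversion set `Φ⁺(v) = {α ∈ Φ⁺ : v(α) ∈ Φ⁻}`. -/
def InvSet (v : V ≃ₗ[ℝ] V) : Set V := {α | α ∈ M.Pos ∧ v α ∈ M.Neg}

/-- `v` belongs to `W^P`: it lies in `W` and has minimal length in its coset `v W_P`. -/
def IsMinRep (v : V ≃ₗ[ℝ] V) : Prop :=
  v ∈ M.W ∧ ∀ u, u ∈ M.W → v⁻¹ * u ∈ M.WP → M.length v ≤ M.length u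

/-- `μ` is the minimal length representative `[w]^P` of the coset `w W_P`. -/
def IsMinRepOf (μ w : V ≃ₗ[ℝ] V) : Prop :=
  (μ ∈ M.W ∧ w⁻¹ * μ ∈ M.WP) ∧
    ∀ u, u ∈ M.W → w⁻¹ * u ∈ M.WP → M.length μ ≤ M.length u

/-- The subset `Φ_S = {α ∈ Φ : σ_S(α) = -α}` determined by an orthogonal set of roots `S`. -/
def PhiSet (S : Finset V) : Set V := {α | α ∈ M.Φ ∧ sigmaOf S α = -α}

/-- A root is long if its squared length is maximal among the roots. -/
def IsLong (α : V) : Prop := ∀ β ∈ M.Φ, ⟪β, β⟫ ≤ ⟪α, α⟫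

/-- Admissible pair: `v ∈ W^P`, `S ⊆ Ψ` a set of pairwise orthogonal roots with
`v(S) ⊆ Φ⁻`. -/
def Admissible (v : V ≃ₗ[ℝ] V) (S : Finset V) : Prop :=
  M.IsMinRep v ∧ (↑S : Set V) ⊆ M.Psi ∧ OrthSet S ∧ ∀ β ∈ S, v β ∈ M.Neg

/-- The length `L(v,S) = (ℓ(σ_{v(S)}) + |S|)/2` of an admissible pair `(v,S)`. -/
def pairL (v : V ≃ₗ[ℝ] V) (S : Finset V) : ℚ :=
  ((M.length (sigmaOf (S.image fun x => v x)) : ℚ) + (S.card : ℚ)) / 2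

end MRSD

namespace RSD

variable {V}
variable (D : RSD V)

lemma exists_linearMap_eq_on_simple (f : V → ℝ) :
    ∃ L : V →ₗ[ℝ] ℝ, ∀ γ ∈ D.Δ, L γ = f γ := by
  let b := Module.Basis.extend D.Δ_indep.linearIndepOn_id
  refine ⟨b.constr ℝ fun x => f x, fun γ hγ => ?_⟩
  have hmem : γ ∈ D.Δ_indep.linearIndepOn_id.extend (Set.subset_univ _) :=
    D.Δ_indep.linearIndepOn_id.subset_extend _ ⟨⟨γ, hγ⟩, rfl⟩
  have h : b ⟨γ, hmem⟩ = γ := Module.Basis.extend_apply_self _ _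
  have h2 := b.constr_basis ℝ (fun x => f x) ⟨γ, hmem⟩
  rwa [h] at h2

lemma map_simple_sum {L : V →ₗ[ℝ] ℝ} {f : V → ℝ} (hL : ∀ γ ∈ D.Δ, L γ = f γ)
    (c : V → ℕ) : L (∑ γ ∈ D.Δ, (c γ : ℝ) • γ) = ∑ γ ∈ D.Δ, (c γ : ℝ) * f γ := by
  rw [map_sum]
  exact Finset.sum_congr rfl fun γ hγ => by rw [map_smul, hL γ hγ, smul_eq_mul]

/-- A linear functional taking the value `1` on each simple root is at least `1` on positive
roots. -/
lemma one_le_height_of_mem_Pos {L : V →ₗ[ℝ] ℝ} (hL : ∀ γ ∈ D.Δ, L γ = 1) {α : V}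
    (hα : α ∈ D.Pos) : 1 ≤ L α := by
  obtain ⟨hΦ, c, hc⟩ := hα
  have h : L α = ((∑ γ ∈ D.Δ, c γ : ℕ) : ℝ) := by
    rw [hc, D.map_simple_sum hL]
    push_cast
    simp
  rw [h]
  norm_cast
  rw [Nat.one_le_iff_ne_zero]
  intro h0
  rw [Finset.sum_eq_zero_iff] at h0
  apply D.nonzero
  have : α = 0 := by
    rw [hc]
    exact Finset.sum_eq_zero fun γ hγ => by rw [h0 γ hγ]; simp
  rwa [← this]

lemma exists_height : ∃ L : V →ₗ[ℝ] ℝ, (∀ γ ∈ D.Δ, L γ = 1) ∧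
    (∀ α ∈ D.Pos, 1 ≤ L α) ∧ ∀ α ∈ D.Neg, L α ≤ -1 := by
  obtain ⟨L, hL⟩ := D.exists_linearMap_eq_on_simple fun _ => 1
  refine ⟨L, hL, fun α hα => D.one_le_height_of_mem_Pos hL hα, fun α hα => ?_⟩
  have := D.one_le_height_of_mem_Pos hL hα
  rw [map_neg] at this
  linarith

lemma inner_self_pos {α : V} (hα : α ∈ D.Φ) : (0 : ℝ) < ⟪α, α⟫ :=
  real_inner_self_pos.2 fun h => D.nonzero (h ▸ hα)

lemma neg_mem {α : V} (hα : α ∈ D.Φ) : -α ∈ D.Φ := by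
  have h := D.reflClosed α hα α hα
  rwa [sref_apply, mul_div_cancel_right₀ _ (D.inner_self_pos hα).ne', two_smul,
    sub_add_cancel_left] at h

lemma mem_Pos_or_mem_Neg {α : V} (hα : α ∈ D.Φ) : α ∈ D.Pos ∨ α ∈ D.Neg :=
  (D.Δ_base α hα).imp (fun h => ⟨hα, h⟩) fun h => ⟨D.neg_mem hα, h⟩

lemma not_mem_Neg_of_mem_Pos {α : V} (hα : α ∈ D.Pos) : α ∉ D.Neg := by
  obtain ⟨L, -, hp, hn⟩ := D.exists_height
  intro h
  linarith [hp α hα, hn α h]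

lemma neg_mem_Neg {α : V} (hα : α ∈ D.Pos) : -α ∈ D.Neg := by
  change - -α ∈ D.Pos
  rwa [neg_neg]

lemma mem_Pos_of_mem_simple {γ : V} (hγ : γ ∈ D.Δ) : γ ∈ D.Pos :=
  ⟨D.Δ_sub hγ, fun x => if x = γ then 1 else 0, by simp [hγ]⟩

/-- The difference of two distinct roots with positive inner product is a root. -/
lemma sub_mem_of_inner_pos {α β : V} (hα : α ∈ D.Φ) (hβ : β ∈ D.Φ) (hne : α ≠ β)
    (h : (0 : ℝ) < ⟪α, β⟫) : α - β ∈ D.Φ := by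
  obtain ⟨p, hp⟩ := D.crystal β hβ α hα
  obtain ⟨q, hq⟩ := D.crystal α hα β hβ
  have ha := D.inner_self_pos hα
  have hb := D.inner_self_pos hβ
  rw [real_inner_comm] at hq
  have hp0 : (0 : ℝ) < p := by rw [hp]; positivity
  have hq0 : (0 : ℝ) < q := by rw [hq]; positivity
  have hcs : (⟪α, β⟫ : ℝ) * ⟪α, β⟫ < ⟪α, α⟫ * ⟪β, β⟫ := by
    refine lt_of_le_of_ne (real_inner_mul_inner_self_le α β) fun he => ?_
    have hz : (⟪β, β⟫ : ℝ) • α - (⟪α, β⟫ : ℝ) • β = 0 := by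
      rw [← inner_self_eq_zero (𝕜 := ℝ)]
      simp only [inner_sub_left, inner_sub_right, real_inner_smul_left,
        real_inner_smul_right, real_inner_comm α β]
      linear_combination (-⟪β, β⟫) * he
    have hm : α = (⟪α, β⟫ / ⟪β, β⟫ : ℝ) • β := by
      rw [div_eq_inv_mul, mul_smul, ← sub_eq_zero.1 hz, smul_smul,
        inv_mul_cancel₀ hb.ne', one_smul]
    rcases D.reduced β hβ _ (hm ▸ hα) with h1 | h1
    · rw [h1, one_smul] at hm
      exact hne hm
    · have : (0 : ℝ) < ⟪α, β⟫ / ⟪β, β⟫ := by positivity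
      linarith
  have hpq : (p : ℝ) * q < 4 := by
    rw [hp, hq, div_mul_div_comm, div_lt_iff₀ (by positivity)]
    linarith
  have hp1 : 0 < p := by exact_mod_cast hp0
  have hq1 : 0 < q := by exact_mod_cast hq0
  have hpq1 : p * q < 4 := by exact_mod_cast hpq
  have hor : p = 1 ∨ q = 1 := by
    by_contra! hc
    have : 2 ≤ p := by omega
    have : 2 ≤ q := by omega
    nlinarith
  rcases hor with h1 | h1
  · have := D.reflClosed β hβ α hα
    rwa [sref_apply, ← hp, h1, Int.cast_one, one_smul] at this
  · have := D.neg_mem (D.reflClosed α hα β hβ)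
    rwa [sref_apply, real_inner_comm, ← hq, h1, Int.cast_one, one_smul, neg_sub] at this

/-- A positive root which is not simple is a sum of two positive roots. -/
lemma exists_add_eq_of_not_simple {α : V} (hα : α ∈ D.Pos) (hs : α ∉ D.Δ) :
    ∃ α₁ ∈ D.Pos, ∃ α₂ ∈ D.Pos, α = α₁ + α₂ := by
  obtain ⟨c, hc⟩ := hα.2
  obtain ⟨γ, hγ, hpos⟩ : ∃ γ ∈ D.Δ, (0 : ℝ) < ⟪α, γ⟫ := by
    by_contra! hn
    have h1 := D.inner_self_pos hα.1
    have h2 : (⟪α, α⟫ : ℝ) = ∑ γ ∈ D.Δ, (c γ : ℝ) * ⟪α, γ⟫ := by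
      conv_lhs => rw [hc, inner_sum, ← hc]
      exact Finset.sum_congr rfl fun γ _ => real_inner_smul_right _ _ _
    have h3 : ∑ γ ∈ D.Δ, (c γ : ℝ) * ⟪α, γ⟫ ≤ 0 :=
      Finset.sum_nonpos fun γ hγ => mul_nonpos_of_nonneg_of_nonpos (by positivity) (hn γ hγ)
    linarith
  have hr : α - γ ∈ D.Φ :=
    D.sub_mem_of_inner_pos hα.1 (D.Δ_sub hγ) (fun h => hs (h ▸ hγ)) hpos
  refine ⟨α - γ, (D.mem_Pos_or_mem_Neg hr).resolve_right fun hneg => ?_, γ,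
    D.mem_Pos_of_mem_simple hγ, by abel⟩
  obtain ⟨L, h1, hp, hn⟩ := D.exists_height
  have := hn _ hneg
  rw [map_sub, h1 γ hγ] at this
  linarith [hp α hα]

/-- A simple reflection makes no positive root negative other than its own root. -/
lemma eq_of_sref_mem_Neg {a δ : V} (ha : a ∈ D.Δ) (hδ : δ ∈ D.Pos)
    (hn : sref V a δ ∈ D.Neg) : δ = a := by
  obtain ⟨hΦ, c, hc⟩ := hδ
  obtain ⟨-, d, hd⟩ := hn
  have hzero : ∀ γ ∈ D.Δ, γ ≠ a → c γ = 0 := by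
    intro γ hγ hne
    obtain ⟨L, hL⟩ := D.exists_linearMap_eq_on_simple fun x => if x = γ then 1 else 0
    have h1 : L δ = c γ := by
      rw [hc, D.map_simple_sum hL]
      simp [hγ]
    have h2 : L (-sref V a δ) = d γ := by
      rw [hd, D.map_simple_sum hL]
      simp [hγ]
    rw [sref_apply, map_neg, map_sub, map_smul, hL a ha, if_neg hne.symm, h1] at h2
    have h3 : (c γ : ℝ) + d γ = 0 := by rw [← h2]; simp
    have h4 : c γ + d γ = 0 := by exact_mod_cast h3
    omega
  have hδ : δ = (c a : ℝ) • a := by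
    rw [hc]
    exact Finset.sum_eq_single_of_mem a ha fun γ hγ hne => by rw [hzero γ hγ hne]; simp
  rcases D.reduced a (D.Δ_sub ha) _ (hδ ▸ hΦ) with h | h
  · rw [hδ, h, one_smul]
  · have : (0 : ℝ) ≤ c a := by positivity
    linarith

lemma sref_mul_self (a : V) : sref V a * sref V a = 1 :=
  LinearEquiv.ext fun x => reflMap_involutive V a x

lemma inner_sref_sref {a : V} (ha : (⟪a, a⟫ : ℝ) ≠ 0) (x y : V) :
    (⟪sref V a x, sref V a y⟫ : ℝ) = ⟪x, y⟫ := by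
  simp only [sref_apply, inner_sub_left, inner_sub_right, real_inner_smul_left,
    real_inner_smul_right]
  rw [real_inner_comm a y]
  field_simp
  ring

lemma sref_mem_W {γ : V} (hγ : γ ∈ D.Δ) : sref V γ ∈ D.W :=
  Subgroup.subset_closure ⟨γ, hγ, rfl⟩

lemma word_mem {l : List V} (hl : ∀ γ ∈ l, γ ∈ D.Δ) {x : V} (hx : x ∈ D.Φ) :
    (l.map (sref V)).prod x ∈ D.Φ := by
  induction l with
  | nil => simpa using hx
  | cons a t ih =>
    rw [List.map_cons, List.prod_cons, LinearEquiv.mul_apply]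
    exact D.reflClosed a (D.Δ_sub (hl a (by simp))) _
      (ih fun γ hγ => hl γ (List.mem_cons_of_mem _ hγ))

lemma inner_word {l : List V} (hl : ∀ γ ∈ l, γ ∈ D.Δ) (x y : V) :
    (⟪(l.map (sref V)).prod x, (l.map (sref V)).prod y⟫ : ℝ) = ⟪x, y⟫ := by
  induction l with
  | nil => simp
  | cons a t ih =>
    rw [List.map_cons, List.prod_cons, LinearEquiv.mul_apply, LinearEquiv.mul_apply,
      inner_sref_sref (D.inner_self_pos (D.Δ_sub (hl a (by simp)))).ne',
      ih fun γ hγ => hl γ (List.mem_cons_of_mem _ hγ)]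

lemma sref_apply_mul {w : V ≃ₗ[ℝ] V} (hw : ∀ x y, (⟪w x, w y⟫ : ℝ) = ⟪x, y⟫) (γ : V) :
    sref V (w γ) * w = w * sref V γ := by
  ext x
  simp only [LinearEquiv.mul_apply, sref_apply, hw, map_sub, map_smul]

/-- The exchange condition for a word in the simple reflections. -/
lemma exists_shorter_word {l : List V} (hl : ∀ γ ∈ l, γ ∈ D.Δ) {γ : V} (hγ : γ ∈ D.Δ)
    (hn : (l.map (sref V)).prod γ ∈ D.Neg) :
    ∃ l' : List V, l'.length < l.length ∧ (∀ x ∈ l', x ∈ D.Δ) ∧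
      (l.map (sref V)).prod * sref V γ = (l'.map (sref V)).prod := by
  induction l with
  | nil => exact absurd hn (D.not_mem_Neg_of_mem_Pos (by simpa using D.mem_Pos_of_mem_simple hγ))
  | cons a t ih =>
    have ht : ∀ x ∈ t, x ∈ D.Δ := fun x hx => hl x (List.mem_cons_of_mem _ hx)
    have ha : a ∈ D.Δ := hl a (by simp)
    rw [List.map_cons, List.prod_cons] at hn ⊢
    rcases D.mem_Pos_or_mem_Neg (D.word_mem ht (D.Δ_sub hγ)) with hp | hp
    · have he := D.eq_of_sref_mem_Neg ha hp hn
      refine ⟨t, by simp, ht, ?_⟩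
      have hc := sref_apply_mul (D.inner_word ht) γ
      rw [he] at hc
      rw [hc, mul_assoc, sref_mul_self, mul_one]
    · obtain ⟨l', h1, h2, h3⟩ := ih ht hp
      refine ⟨a :: l', by simpa using h1, ?_, ?_⟩
      · intro x hx
        rcases List.mem_cons.1 hx with rfl | hx
        · exact ha
        · exact h2 x hx
      · rw [List.map_cons, List.prod_cons, mul_assoc, h3]

lemma inv_word (l : List V) :
    ((l.map (sref V)).prod)⁻¹ = (l.reverse.map (sref V)).prod := by
  induction l with
  | nil => simp
  | cons a t ih =>
    rw [List.map_cons, List.prod_cons, mul_inv_rev, ih, List.reverse_cons, List.map_append,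
      List.prod_append, List.map_singleton, List.prod_singleton,
      inv_eq_of_mul_eq_one_left (sref_mul_self a)]

lemma exists_word {w : V ≃ₗ[ℝ] V} (hw : w ∈ D.W) :
    ∃ l : List V, (∀ γ ∈ l, γ ∈ D.Δ) ∧ w = (l.map (sref V)).prod := by
  induction hw using Subgroup.closure_induction with
  | mem x hx =>
    obtain ⟨γ, hγ, rfl⟩ := hx
    exact ⟨[γ], by simpa using hγ, by simp⟩
  | one => exact ⟨[], by simp, by simp⟩
  | mul x y _ _ hx hy =>
    obtain ⟨l, hl, rfl⟩ := hx
    obtain ⟨m, hm, rfl⟩ := hy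
    refine ⟨l ++ m, fun γ hγ => ?_, by simp⟩
    rcases List.mem_append.1 hγ with h | h
    · exact hl γ h
    · exact hm γ h
  | inv x _ hx =>
    obtain ⟨l, hl, rfl⟩ := hx
    exact ⟨l.reverse, by simpa using hl, inv_word l⟩

lemma length_le {l : List V} (hl : ∀ γ ∈ l, γ ∈ D.Δ) :
    D.length (l.map (sref V)).prod ≤ l.length :=
  Nat.sInf_le ⟨l, rfl, hl, rfl⟩

lemma exists_reduced_word {w : V ≃ₗ[ℝ] V} (hw : w ∈ D.W) :
    ∃ l : List V, l.length = D.length w ∧ (∀ γ ∈ l, γ ∈ D.Δ) ∧ w = (l.map (sref V)).prod := by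
  obtain ⟨l, hl, h⟩ := D.exists_word hw
  exact Nat.sInf_mem
    (s := {n | ∃ l : List V, l.length = n ∧ (∀ γ ∈ l, γ ∈ D.Δ) ∧ w = (l.map (sref V)).prod})
    ⟨_, l, rfl, hl, h⟩

lemma length_mul_sref_lt {w : V ≃ₗ[ℝ] V} (hw : w ∈ D.W) {γ : V} (hγ : γ ∈ D.Δ)
    (hn : w γ ∈ D.Neg) : D.length (w * sref V γ) < D.length w := by
  obtain ⟨l, h1, h2, h3⟩ := D.exists_reduced_word hw
  rw [h3] at hn
  obtain ⟨l', h4, h5, h6⟩ := D.exists_shorter_word h2 hγ hn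
  rw [← h1]
  refine lt_of_le_of_lt ?_ h4
  rw [h3, h6]
  exact D.length_le h5

lemma length_inv_le {w : V ≃ₗ[ℝ] V} (hw : w ∈ D.W) : D.length w⁻¹ ≤ D.length w := by
  obtain ⟨l, h1, h2, h3⟩ := D.exists_reduced_word hw
  rw [← h1, h3, inv_word, ← List.length_reverse]
  exact D.length_le (by simpa using h2)

lemma length_sref_mul_lt {w : V ≃ₗ[ℝ] V} (hw : w ∈ D.W) {γ : V} (hγ : γ ∈ D.Δ)
    (hn : w⁻¹ γ ∈ D.Neg) : D.length (sref V γ * w) < D.length w := by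
  have h1 := D.length_mul_sref_lt (inv_mem hw) hγ hn
  have h2 := D.length_inv_le (mul_mem (inv_mem hw) (D.sref_mem_W hγ))
  rw [mul_inv_rev, inv_inv, inv_eq_of_mul_eq_one_left (sref_mul_self γ)] at h2
  exact (h2.trans_lt h1).trans_le (D.length_inv_le hw)

lemma map_mem {w : V ≃ₗ[ℝ] V} (hw : w ∈ D.W) {x : V} (hx : x ∈ D.Φ) : w x ∈ D.Φ := by
  obtain ⟨l, hl, rfl⟩ := D.exists_word hw
  exact D.word_mem hl hx

end RSD

namespace MRSD

variable {V}
variable (M : MRSD V)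

lemma IsMinRep.map_simple_mem_Pos {M : MRSD V} {v : V ≃ₗ[ℝ] V} (hv : M.IsMinRep v) {γ : V}
    (hγ : γ ∈ M.Δ) (hne : γ ≠ M.αP) : v γ ∈ M.Pos := by
  refine (M.mem_Pos_or_mem_Neg (M.map_mem hv.1 (M.Δ_sub hγ))).resolve_right fun hn => ?_
  refine (M.length_mul_sref_lt hv.1 hγ hn).not_ge
    (hv.2 _ (mul_mem hv.1 (M.sref_mem_W hγ)) ?_)
  rw [inv_mul_cancel_left]
  exact Subgroup.subset_closure ⟨γ, Finset.mem_coe.2 (Finset.mem_erase.2 ⟨hne, hγ⟩), rfl⟩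

/-- The marked coefficient functional is at least `1` on the inversions of a minimal coset
representative. -/
lemma IsMinRep.one_le_marked_coeff {M : MRSD V} {v : V ≃ₗ[ℝ] V} (hv : M.IsMinRep v)
    {L : V →ₗ[ℝ] ℝ} (hL : ∀ γ ∈ M.Δ, L γ = if γ = M.αP then 1 else 0) {δ : V}
    (hδ : δ ∈ M.InvSet v) : 1 ≤ L δ := by
  obtain ⟨⟨-, c, hc⟩, hn⟩ := hδ
  have h1 : L δ = c M.αP := by
    rw [hc, M.map_simple_sum hL]
    simp [M.αP_mem]
  rw [h1, Nat.one_le_cast, Nat.one_le_iff_ne_zero]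
  intro h0
  obtain ⟨H, -, hp, hneg⟩ := M.exists_height
  have h2 : 0 ≤ H (v δ) := by
    rw [hc, map_sum, map_sum]
    refine Finset.sum_nonneg fun γ hγ => ?_
    rw [map_smul, map_smul, smul_eq_mul]
    by_cases he : γ = M.αP
    · simp [he, h0]
    · have := hp _ (hv.map_simple_mem_Pos hγ he)
      positivity
  linarith [hneg _ hn]

lemma marked_coeff_le_one {L : V →ₗ[ℝ] ℝ} (hL : ∀ γ ∈ M.Δ, L γ = if γ = M.αP then 1 else 0)
    {δ : V} (hδ : δ ∈ M.Φ) : L δ ≤ 1 := by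
  obtain ⟨c, hc⟩ := M.θ_high δ hδ
  obtain ⟨d, hd, hd1⟩ := M.θ_coeff
  have h1 : L M.θ = 1 := by
    rw [hd, M.map_simple_sum hL]
    simp [M.αP_mem, hd1]
  have h2 : L (M.θ - δ) = c M.αP := by
    rw [hc, M.map_simple_sum hL]
    simp [M.αP_mem]
  rw [map_sub, h1] at h2
  have : (0 : ℝ) ≤ c M.αP := by positivity
  linarith

end MRSD

/-- Let `v ∈ W^P` and let `β` be maximal in `Φ⁺(v)` for the dominance
order, and set `α = -v(β)`.  Then `α` is a simple root and `s_α v < v`. -/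
theorem statement5 {V : Type} [NormedAddCommGroup V] [InnerProductSpace ℝ V]
    [FiniteDimensional ℝ V]
    (M : MRSD V) (v : V ≃ₗ[ℝ] V) (β : V)
    (hv : M.IsMinRep v) (hβ : β ∈ M.InvSet v)
    (hmax : ∀ γ ∈ M.InvSet v, M.dom β γ → γ = β) :
    -(v β) ∈ M.Δ ∧ M.blt (sref V (-(v β)) * v) v := by
  have hW := hv.1
  have hsimple : -(v β) ∈ M.Δ := by
    by_contra hs
    obtain ⟨α₁, h₁, α₂, h₂, hsum⟩ := M.exists_add_eq_of_not_simple hβ.2 hs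
    have hvinv : ∀ x, v (-(v⁻¹ x)) = -x := fun x => by
      rw [map_neg]
      exact congrArg Neg.neg (v.apply_symm_apply x)
    have hmem : ∀ x ∈ M.Pos, -(v⁻¹ x) ∈ M.Φ := fun x hx =>
      M.neg_mem (M.map_mem (inv_mem hW) hx.1)
    have hinv : ∀ x ∈ M.Pos, -(v⁻¹ x) ∈ M.Pos → -(v⁻¹ x) ∈ M.InvSet v := fun x hx hp =>
      ⟨hp, by rw [hvinv]; exact M.neg_mem_Neg hx⟩
    have hadd : β = -(v⁻¹ α₁) + -(v⁻¹ α₂) := by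
      apply v.injective
      rw [map_add, hvinv, hvinv, ← neg_add, ← hsum, neg_neg]
    have key : ∀ x y : V, x ∈ M.InvSet v → y ∈ M.Neg → β = x + y → False := by
      intro x y hx hy he
      have hxβ : x = β := hmax x hx (by
        obtain ⟨c, hc⟩ := hy.2
        exact ⟨c, by rw [← hc, he]; abel⟩)
      have hy0 : y = 0 := by simpa [hxβ] using he
      apply M.nonzero
      simpa [hy0] using hy.1
    rcases M.mem_Pos_or_mem_Neg (hmem α₁ h₁) with hp₁ | hn₁ <;>
      rcases M.mem_Pos_or_mem_Neg (hmem α₂ h₂) with hp₂ | hn₂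
    · obtain ⟨L, hL⟩ := M.exists_linearMap_eq_on_simple fun x => if x = M.αP then 1 else 0
      have h3 := hv.one_le_marked_coeff hL (hinv _ h₁ hp₁)
      have h4 := hv.one_le_marked_coeff hL (hinv _ h₂ hp₂)
      have h5 := M.marked_coeff_le_one hL hβ.1.1
      rw [hadd, map_add] at h5
      linarith
    · exact key _ _ (hinv _ h₁ hp₁) hn₂ hadd
    · exact key _ _ (hinv _ h₂ hp₂) hn₁ (by rw [hadd, add_comm])
    · obtain ⟨H, -, hp, hn⟩ := M.exists_height
      have h3 := hp _ hβ.1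
      rw [hadd, map_add] at h3
      linarith [hn _ hn₁, hn _ hn₂]
  have hlt : M.length (sref V (-(v β)) * v) < M.length v := by
    refine M.length_sref_mul_lt hW hsimple ?_
    have h : v⁻¹ (-(v β)) = -β := by
      rw [map_neg]
      exact congrArg Neg.neg (v.symm_apply_apply β)
    rw [h]
    exact M.neg_mem_Neg hβ.1
  refine ⟨hsimple, Relation.ReflTransGen.single ⟨⟨_, M.Δ_sub hsimple, ?_⟩, hlt⟩, fun h => ?_⟩
  · rw [← mul_assoc, RSD.sref_mul_self, one_mul]
  · rw [h] at hlt
    exact lt_irrefl _ hlt
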